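/- arXiv:1602.01706 — 10 statements merged into one kernel-verified Lean document; each statement's English description precedes it below -/
import Mathlib

section
/- Let r ≥ 2 and N ≥ 2 be integers, let ζ_N = e^{2πi/N}, and let χ : ℤ → ℂ be a symmetric function mod N of parity r. Then the associated L-series satisfies L(r,χ) = Σ_{n=1}^∞ χ(n)/n^r = (1/2)·(1/(r−1)!)·(−2πi/N)^r · Σ_{a=1}^{N−1} χ(a)·h_r(ζ_N^a). -/
/-- The auxiliary functions `h_r : ℂ ∖ {1} → ℂ` of Kato–Kurokawa–Saito:
`h 1 t = (1+t)/(2(1-t))` and `h (r+1) t = t * (h r)'(t)`. (`auxH 0` is junk.) -/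
noncomputable def auxH : ℕ → ℂ → ℂ
  | 0 => fun _ => 0
  | 1 => fun t => (1 + t) / (2 * (1 - t))
  | (n + 2) => fun t => t * deriv (auxH (n + 1)) t

/-- A symmetric function mod `N` of parity `r`: `χ (k*N) = 0`, `χ` is `N`-periodic,
and `χ (N - a) = (-1)^r * χ a` for `1 ≤ a ≤ N-1`. -/
def IsSymmetricFun (N r : ℕ) (χ : ℤ → ℂ) : Prop :=
  (∀ k : ℤ, χ (k * N) = 0) ∧
  (∀ k : ℤ, ∀ a : ℕ, 1 ≤ a → a ≤ N - 1 → χ (k * N + a) = χ a) ∧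
  (∀ a : ℕ, 1 ≤ a → a ≤ N - 1 → χ ((N : ℤ) - a) = (-1) ^ r * χ a)

open Complex Filter Topology in
lemma auxH_diff (k : ℕ) : DifferentiableOn ℂ (auxH (k + 1)) ({1}ᶜ : Set ℂ) := by
  induction k with
  | zero =>
    intro t ht
    have h : (2 * (1 - t)) ≠ 0 := mul_ne_zero two_ne_zero (sub_ne_zero.2 (Ne.symm ht))
    have : DifferentiableAt ℂ (fun t : ℂ => (1 + t) / (2 * (1 - t))) t := by
      refine DifferentiableAt.fun_div (c := fun t : ℂ => 1 + t) (d := fun t : ℂ => 2 * (1 - t)) ?_ ?_ h <;> fun_prop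
    exact this.differentiableWithinAt
  | succ k ih =>
    exact differentiableOn_id.mul (ih.deriv isOpen_compl_singleton)

lemma exp_ne_one_of_im_pos {z : ℂ} (hz : 0 < z.im) :
    Complex.exp (2 * Real.pi * Complex.I * z) ≠ 1 := by
  intro h
  have := UpperHalfPlane.norm_exp_two_pi_I_lt_one ⟨z, hz⟩
  simp only [UpperHalfPlane.coe_mk] at this
  rw [h] at this
  simp at this

open Complex Filter Topology in
lemma iter_cot (k : ℕ) : ∀ z ∈ UpperHalfPlane.upperHalfPlaneSet,
    iteratedDerivWithin k (fun x : ℂ ↦ Real.pi * cot (Real.pi * x))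
      UpperHalfPlane.upperHalfPlaneSet z
    = -(2 * Real.pi * I) ^ (k + 1) * auxH (k + 1) (exp (2 * Real.pi * I * z)) := by
  induction k with
  | zero =>
    intro z hz
    have h : 1 - exp (2 * Real.pi * I * z) ≠ 0 :=
      sub_ne_zero.2 (Ne.symm (exp_ne_one_of_im_pos hz))
    simp only [iteratedDerivWithin_zero, cot_pi_eq_exp_ratio, auxH]
    generalize exp (2 * Real.pi * I * z) = q at h
    rw [zero_add, pow_one]
    have h2 : (q + 1) / (I * (1 - q)) = -I * ((q + 1) / (1 - q)) := by
      rw [div_eq_iff (mul_ne_zero I_ne_zero h)]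
      field_simp
      rw [I_sq]
      ring
    rw [h2]
    field_simp
    ring
  | succ k ih =>
    intro z hz
    have hne := exp_ne_one_of_im_pos hz
    rw [iteratedDerivWithin_succ, derivWithin_congr ih (ih z hz),
      derivWithin_of_isOpen UpperHalfPlane.isOpen_upperHalfPlaneSet hz]
    have h1 : HasDerivAt (auxH (k + 1)) (deriv (auxH (k + 1)) (exp (2 * Real.pi * I * z)))
        (exp (2 * Real.pi * I * z)) :=
      ((auxH_diff k).differentiableAt (isOpen_compl_singleton.mem_nhds hne)).hasDerivAt
    have h2 : HasDerivAt (fun z : ℂ => exp (2 * Real.pi * I * z))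
        (exp (2 * Real.pi * I * z) * (2 * Real.pi * I * 1)) z :=
      ((hasDerivAt_id z).const_mul _).cexp
    have h3 := ((h1.comp z h2).const_mul (-(2 * Real.pi * I) ^ (k + 1))).deriv
    simp only [Function.comp_def] at h3
    rw [h3]
    simp only [auxH]
    ring

lemma upper_sum (k : ℕ) (hk : 1 ≤ k) (z : ℂ) (hz : 0 < z.im) :
    ∑' n : ℤ, 1 / (z + n) ^ (k + 1) = (-2 * Real.pi * Complex.I) ^ (k + 1) / (k.factorial : ℂ) *
      auxH (k + 1) (Complex.exp (2 * Real.pi * Complex.I * z)) := by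
  have h1 := iteratedDerivWithin_cot_pi_mul_eq_mul_tsum_div_pow hk (z := z) hz
  rw [iter_cot k z hz] at h1
  have hf : (k.factorial : ℂ) ≠ 0 := by exact_mod_cast k.factorial_ne_zero
  have hs : ((-1 : ℂ) ^ k) * (-1) ^ k = 1 := by rw [← mul_pow]; simp
  have e : (-2 * Real.pi * Complex.I : ℂ) ^ (k + 1)
      = (-1) ^ k * -(2 * Real.pi * Complex.I : ℂ) ^ (k + 1) := by
    rw [show (-2 * Real.pi * Complex.I : ℂ) = (-1) * (2 * Real.pi * Complex.I) by ring, mul_pow]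
    ring
  rw [e, div_mul_eq_mul_div, eq_div_iff hf, mul_assoc, h1]
  linear_combination (-(k.factorial : ℂ) * ∑' n : ℤ, 1 / (z + n) ^ (k + 1)) * hs

lemma summable_shift (k : ℕ) (hk : 1 ≤ k) (x : ℝ) :
    Summable fun n : ℤ => 1 / |x + n| ^ (k + 1) := by
  have := (Real.summable_one_div_int_add_rpow x (k + 1 : ℕ)).2 (by exact_mod_cast (by omega))
  simp only [Real.rpow_natCast] at this
  simpa only [add_comm] using this

open Complex Filter Topology in
lemma real_sum (k : ℕ) (hk : 1 ≤ k) (x : ℝ) (hx : ∀ n : ℤ, x ≠ n) :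
    ∑' n : ℤ, 1 / ((x : ℂ) + n) ^ (k + 1) = (-2 * Real.pi * I) ^ (k + 1) / (k.factorial : ℂ) *
      auxH (k + 1) (exp (2 * Real.pi * I * x)) := by
  have hxn : ∀ n : ℤ, x + n ≠ 0 := fun n h => hx (-n) (by push_cast; linarith)
  have hT : Tendsto (fun t : ℝ => (x : ℂ) + t * I) (𝓝[>] 0) (𝓝 (x : ℂ)) := by
    have : Continuous (fun t : ℝ => (x : ℂ) + t * I) := by fun_prop
    have := (this.tendsto 0).mono_left (nhdsWithin_le_nhds (s := Set.Ioi 0))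
    simpa using this
  have hL : Tendsto (fun t : ℝ => ∑' n : ℤ, 1 / (((x : ℂ) + t * I) + n) ^ (k + 1)) (𝓝[>] 0)
      (𝓝 (∑' n : ℤ, 1 / ((x : ℂ) + n) ^ (k + 1))) := by
    refine tendsto_tsum_of_dominated_convergence (summable_shift k hk x) ?_ ?_
    · intro n
      have h0 : ((x : ℂ) + n) ^ (k + 1) ≠ 0 := pow_ne_zero _ (by exact_mod_cast hxn n)
      exact tendsto_const_nhds.div ((hT.add_const _).pow _) h0
    · refine Eventually.of_forall fun t n => ?_
      rw [norm_div, norm_pow, norm_one]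
      have h0 : 0 < |x + n| := abs_pos.2 (hxn n)
      have h1 : |x + n| ≤ ‖(x : ℂ) + t * I + n‖ := by
        have := abs_re_le_norm ((x : ℂ) + t * I + n)
        simpa using this
      gcongr
  have hne : exp (2 * Real.pi * I * x) ≠ 1 := by
    intro h
    obtain ⟨n, hn⟩ := exp_eq_one_iff.1 h
    have hp : (2 * Real.pi * I : ℂ) ≠ 0 := two_pi_I_ne_zero
    rw [mul_comm] at hn
    exact hx n (by exact_mod_cast mul_right_cancel₀ hp hn)
  have hR : Tendsto (fun t : ℝ => (-2 * Real.pi * I) ^ (k + 1) / (k.factorial : ℂ) *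
      auxH (k + 1) (exp (2 * Real.pi * I * ((x : ℂ) + t * I)))) (𝓝[>] 0)
      (𝓝 ((-2 * Real.pi * I) ^ (k + 1) / (k.factorial : ℂ) *
      auxH (k + 1) (exp (2 * Real.pi * I * x)))) := by
    refine Tendsto.const_mul _ ?_
    have hc := ((auxH_diff k).differentiableAt
      (isOpen_compl_singleton.mem_nhds hne)).continuousAt.tendsto
    exact hc.comp ((continuous_exp.tendsto _).comp (hT.const_mul _))
  refine tendsto_nhds_unique (hL.congr' ?_) hR
  filter_upwards [self_mem_nhdsWithin] with t ht
  exact upper_sum k hk _ (by simpa using ht)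

lemma tsum_mod (N : ℕ) [NeZero N] (F : ℤ → ℂ) (hsum : Summable F) :
    ∑' n : ℤ, F n = ∑ a ∈ Finset.range N, ∑' q : ℤ, F (q * N + a) := by
  let e : Fin N × ℤ ≃ ℤ := (Equiv.prodComm _ _).trans (Int.divModEquiv N).symm
  have he : ∀ p, e p = p.2 * N + (p.1 : ℕ) := fun p => rfl
  have hs2 : Summable fun p : Fin N × ℤ => F (p.2 * N + (p.1 : ℕ)) := by
    have := e.summable_iff.2 hsum
    simpa only [Function.comp_def, he] using this
  rw [← e.tsum_eq F]
  simp only [he]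
  rw [hs2.tsum_prod, tsum_fintype, Finset.sum_range]

/-- Theorem 2.3: for `r ≥ 2`, `N ≥ 2` and a symmetric function `χ` mod `N` of parity `r`,
`L(r,χ) = (1/2)·(1/(r-1)!)·(-2πi/N)^r · Σ_{a=1}^{N-1} χ(a)·h_r(ζ_N^a)`. -/
theorem lseries_symmetricFun_eq (r N : ℕ) (hr : 2 ≤ r) (hN : 2 ≤ N) (χ : ℤ → ℂ)
    (hχ : IsSymmetricFun N r χ) :
    ∑' n : ℕ, χ (n + 1) / ((n : ℂ) + 1) ^ r =
      (1 / 2) * (1 / (Nat.factorial (r - 1) : ℂ)) *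
        (-2 * (Real.pi : ℂ) * Complex.I / (N : ℂ)) ^ r *
        ∑ a ∈ Finset.Icc 1 (N - 1),
          χ (a : ℤ) * auxH r (Complex.exp (2 * (Real.pi : ℂ) * Complex.I / (N : ℂ)) ^ a) := by
  obtain ⟨h0, hper, hsym⟩ := hχ
  obtain ⟨k, rfl⟩ : ∃ k, r = k + 1 := ⟨r - 1, by omega⟩
  have hk : 1 ≤ k := by omega
  haveI : NeZero N := ⟨by omega⟩
  have hNZ : (N : ℤ) ≠ 0 := by exact_mod_cast (NeZero.ne N)
  have hNC : (N : ℂ) ≠ 0 := by exact_mod_cast (NeZero.ne N)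
  have hz0 : χ 0 = 0 := by simpa using h0 0
  have hper' : ∀ (q : ℤ) (a : ℕ), a < N → χ (q * N + a) = χ a := by
    intro q a ha
    rcases Nat.eq_zero_or_pos a with rfl | hp
    · simp [h0, hz0]
    · exact hper q a hp (by omega)
  have hdecomp : ∀ n : ℤ, ∃ (q : ℤ) (a : ℕ), a < N ∧ n = q * N + a := by
    intro n
    have h1 := Int.emod_nonneg n hNZ
    have h2 := Int.emod_lt_of_pos n (show (0 : ℤ) < N by omega)
    refine ⟨n / N, (n % N).toNat, by omega, ?_⟩
    rw [Int.toNat_of_nonneg h1]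
    have := Int.mul_ediv_add_emod n N
    linarith [mul_comm (N : ℤ) (n / N)]
  have hneg : ∀ n : ℤ, χ (-n) = (-1) ^ (k + 1) * χ n := by
    intro n
    obtain ⟨q, a, ha, rfl⟩ := hdecomp n
    rw [hper' q a ha]
    rcases Nat.eq_zero_or_pos a with rfl | hp
    · have := h0 (-q)
      simp only [Nat.cast_zero, add_zero, hz0, mul_zero]
      rw [← this]; congr 1; ring
    · rw [← hsym a hp (by omega)]
      have := hper' (-q - 1) (N - a) (by omega)
      rw [Nat.cast_sub ha.le] at this
      rw [← this]; congr 1; ring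
  set F : ℤ → ℂ := fun n => χ n / (n : ℂ) ^ (k + 1) with hF
  have hbd : ∀ n : ℤ, ‖χ n‖ ≤ ∑ a ∈ Finset.range N, ‖χ a‖ := by
    intro n
    obtain ⟨q, a, ha, rfl⟩ := hdecomp n
    rw [hper' q a ha]
    exact Finset.single_le_sum (f := fun a : ℕ => ‖χ a‖) (fun _ _ => norm_nonneg _)
      (Finset.mem_range.2 ha)
  have hsum : Summable F := by
    refine Summable.of_norm_bounded
      ((summable_shift k hk 0).mul_left (∑ a ∈ Finset.range N, ‖χ a‖)) fun n => ?_
    have : ‖(n : ℂ)‖ = |(n : ℝ)| := by simp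
    rw [hF]
    simp only [norm_div, norm_pow, this, zero_add]
    rw [div_eq_mul_one_div]
    gcongr
    exact hbd n
  have heven : F.Even := by
    intro n
    simp only [hF, hneg]
    push_cast
    rw [neg_pow (n : ℂ), mul_div_mul_left _ _ (pow_ne_zero _ (by norm_num))]
  have hA : ∑' n : ℤ, F n = 2 * ∑' n : ℕ, χ (n + 1) / ((n : ℂ) + 1) ^ (k + 1) := by
    rw [tsum_int_eq_zero_add_two_mul_tsum_pnat heven hsum]
    rw [tsum_pnat_eq_tsum_succ (f := fun n : ℕ => F n)]
    simp [hF, hz0]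
  have hB : ∑' n : ℤ, F n = ∑ a ∈ Finset.range N, ∑' q : ℤ, F (q * N + a) :=
    tsum_mod N F hsum
  have hC : ∀ a ∈ Finset.Icc 1 (N - 1), ∑' q : ℤ, F (q * N + a) =
      (1 / (Nat.factorial k : ℂ)) * (-2 * (Real.pi : ℂ) * Complex.I / (N : ℂ)) ^ (k + 1) *
      (χ (a : ℤ) * auxH (k + 1) (Complex.exp (2 * (Real.pi : ℂ) * Complex.I / (N : ℂ)) ^ a)) := by
    intro a ha
    rw [Finset.mem_Icc] at ha
    have hx : ∀ n : ℤ, ((a : ℝ) / N) ≠ n := by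
      intro n hn
      have hNR : (N : ℝ) ≠ 0 := by exact_mod_cast (NeZero.ne N)
      rw [div_eq_iff hNR] at hn
      have hn' : (a : ℤ) = n * N := by exact_mod_cast hn
      have hd : (N : ℤ) ∣ a := ⟨n, by rw [hn']; ring⟩
      have := Nat.le_of_dvd (by omega) (Int.natCast_dvd_natCast.1 hd)
      omega
    have h1 := real_sum k hk _ hx
    have h2 : ∀ q : ℤ, F (q * N + a) =
        χ a / (N : ℂ) ^ (k + 1) * (1 / ((((a : ℝ) / N : ℝ) : ℂ) + q) ^ (k + 1)) := by
      intro q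
      simp only [hF]
      rw [hper' q a (by omega), div_mul_div_comm, mul_one, ← mul_pow]
      congr 2
      push_cast
      field_simp
      ring
    simp_rw [h2]
    rw [tsum_mul_left, h1, ← Complex.exp_nat_mul, div_pow]
    have : (2 * Real.pi * Complex.I * (((a : ℝ) / N : ℝ) : ℂ))
      = a * (2 * Real.pi * Complex.I / N) := by push_cast; ring
    rw [this]
    ring
  have hI : ∑ a ∈ Finset.range N, ∑' q : ℤ, F (q * N + a)
      = ∑ a ∈ Finset.Icc 1 (N - 1), ∑' q : ℤ, F (q * N + a) := by
    symm
    apply Finset.sum_subset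
    · intro a ha
      rw [Finset.mem_Icc] at ha
      rw [Finset.mem_range]; omega
    · intro a ha hna
      rw [Finset.mem_range] at ha
      rw [Finset.mem_Icc] at hna
      obtain rfl : a = 0 := by omega
      simp [hF, h0]
  rw [hI, Finset.sum_congr rfl hC, ← Finset.mul_sum, hA] at hB
  simp only [Nat.add_sub_cancel]
  linear_combination (1 / 2) * hB
end

section
/- For every integer m ≥ 2, the L-series of the symmetric function χ_{2m} at r = 3 satisfies L(3,χ_{2m}) = Σ_{n=1}^∞ χ_{2m}(n)/n³ = (π³/(4m³)) · Σ_{a=1}^{m−1} sin(aπ/m)/(1 − cos(aπ/m))². -/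
/-- The symmetric function `χ_{2m}` mod `2m`: value `1` on residues `1,…,m-1`,
`0` on residues `0` and `m`, and `-1` on residues `m+1,…,2m-1`. -/
noncomputable def chi2m (m : ℕ) : ℤ → ℂ := fun n =>
  let a := n % (2 * m)
  if a = 0 then 0
  else if a < m then 1
  else if a = m then 0
  else -1

open Filter Topology in
lemma aux_sq (q : ℂ) (hq : ‖q‖ < 1) :
    ∑' n : ℕ, (n : ℂ) ^ 2 * q ^ n = q * (1 + q) / (1 - q) ^ 3 := by
  have h0 := hasSum_choose_mul_geometric_of_norm_lt_one 0 hq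
  have h1 := hasSum_choose_mul_geometric_of_norm_lt_one 1 hq
  have h2 := hasSum_choose_mul_geometric_of_norm_lt_one 2 hq
  have hne : 1 - q ≠ 0 := by
    intro h
    have : q = 1 := by linear_combination -h
    rw [this] at hq
    simp at hq
  have h := ((h2.mul_left 2).sub (h1.mul_left 3)).add h0
  have e : (fun n : ℕ => (n : ℂ) ^ 2 * q ^ n) = fun n : ℕ =>
      2 * (((n + 2).choose 2 : ℕ) * q ^ n) - 3 * (((n + 1).choose 1 : ℕ) * q ^ n)
        + ((n + 0).choose 0 : ℕ) * q ^ n := by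
    funext n
    rw [Nat.cast_choose_two]
    push_cast [Nat.choose_one_right, Nat.choose_zero_right]
    ring
  rw [e, h.tsum_eq]
  field_simp
  ring

open Filter Topology in
lemma aux_int (x : ℝ) (hx0 : 0 < x) (hx1 : x < 1) :
    HasSum (fun n : ℤ => 1 / ((x : ℂ) + n) ^ 3)
      ((Real.pi ^ 3 * Real.cos (Real.pi * x) / Real.sin (Real.pi * x) ^ 3 : ℝ) : ℂ) := by
  have hne : ∀ n : ℤ, x + n ≠ 0 := by
    intro n hn
    have h1 : (-1 : ℝ) < n := by linarith
    have h2 : (n : ℝ) < 0 := by linarith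
    have h1' : (-1 : ℤ) < n := by exact_mod_cast h1
    have h2' : n < 0 := by exact_mod_cast h2
    omega
  have hneC : ∀ n : ℤ, (x : ℂ) + n ≠ 0 := fun n => by exact_mod_cast hne n
  have hsum : Summable (fun n : ℤ => 1 / ((x : ℂ) + n) ^ 3) := by
    have := EisensteinSeries.linear_right_summable (x : ℂ) 1 (k := 3) (by norm_num)
    refine this.congr fun n => ?_
    simp
  have hs : Real.sin (Real.pi * x) ≠ 0 := by
    apply ne_of_gt
    apply Real.sin_pos_of_pos_of_lt_pi
    · positivity
    · nlinarith [Real.pi_pos]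
  let z : ℝ → ℂ := fun t => x + t * Complex.I
  have hz : Continuous z := by fun_prop
  have hq1 : 1 - Complex.exp (2 * Real.pi * Complex.I * z 0) ≠ 0 := by
    intro h
    have h' : Complex.exp (2 * Real.pi * Complex.I * z 0) = 1 := by linear_combination -h
    obtain ⟨n, hn⟩ := Complex.exp_eq_one_iff.mp h'
    have hp : (2 * Real.pi * Complex.I : ℂ) ≠ 0 := Complex.two_pi_I_ne_zero
    have : z 0 = n := by
      apply mul_left_cancel₀ hp
      linear_combination hn
    apply hneC (-n)
    simp [z] at this
    simp [this]
  have hL : Tendsto (fun t : ℝ => ∑' n : ℤ, 1 / (z t + n) ^ 3) (𝓝[>] 0)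
      (𝓝 (∑' n : ℤ, 1 / ((x : ℂ) + n) ^ 3)) := by
    apply tendsto_tsum_of_dominated_convergence hsum.norm
    · intro n
      have : ContinuousAt (fun t : ℝ => 1 / (z t + n) ^ 3) 0 := by
        apply ContinuousAt.div (by fun_prop) (by fun_prop)
        simpa [z] using hneC n
      have h2 := this.tendsto
      simp only [z, Complex.ofReal_zero, zero_mul, add_zero] at h2
      exact h2.mono_left nhdsWithin_le_nhds
    · filter_upwards with t n
      rw [norm_div, norm_div, norm_pow, norm_pow]
      have h1 : ‖(x : ℂ) + n‖ ≤ ‖z t + n‖ := by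
        have h3 := Complex.abs_re_le_norm (z t + n)
        have h4 : (x : ℂ) + n = ((x + n : ℝ) : ℂ) := by push_cast; ring
        rw [h4, Complex.norm_real, Real.norm_eq_abs]
        simpa [z] using h3
      have h2 : 0 < ‖(x : ℂ) + n‖ := norm_pos_iff.mpr (hneC n)
      gcongr
  let F : ℝ → ℂ := fun t => ((-2 * Real.pi * Complex.I) ^ 3 / 2) *
      (Complex.exp (2 * Real.pi * Complex.I * z t) *
        (1 + Complex.exp (2 * Real.pi * Complex.I * z t)) /
        (1 - Complex.exp (2 * Real.pi * Complex.I * z t)) ^ 3)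
  have hR : Tendsto F (𝓝[>] 0) (𝓝 (F 0)) := by
    have : ContinuousAt F 0 := by
      apply ContinuousAt.mul (by fun_prop)
      apply ContinuousAt.div (by fun_prop) (by fun_prop)
      exact pow_ne_zero _ hq1
    exact this.tendsto.mono_left nhdsWithin_le_nhds
  have hEq : F =ᶠ[𝓝[>] 0] (fun t : ℝ => ∑' n : ℤ, 1 / (z t + n) ^ 3) := by
    filter_upwards [self_mem_nhdsWithin] with t ht
    have ht : 0 < t := ht
    have him : 0 < (z t).im := by simpa [z] using ht
    have := EisensteinSeries.qExpansion_identity (k := 2) (by norm_num) ⟨z t, him⟩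
    simp only [Nat.reduceAdd] at this
    have hq : ‖Complex.exp (2 * Real.pi * Complex.I * z t)‖ < 1 := by
      rw [Complex.norm_exp, Real.exp_lt_one_iff]
      simp [z]
      positivity
    refine Eq.trans ?_ this.symm
    simp only [F]
    rw [← aux_sq _ hq]
    simp
  have hlim := tendsto_nhds_unique hL (hR.congr' hEq)
  have hF : F 0 = ((Real.pi ^ 3 * Real.cos (Real.pi * x) / Real.sin (Real.pi * x) ^ 3 : ℝ) : ℂ) := by
    set e := Complex.exp (Real.pi * x * Complex.I) with he
    have he0 : e ≠ 0 := Complex.exp_ne_zero _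
    have hqe : Complex.exp (2 * Real.pi * Complex.I * z 0) = e ^ 2 := by
      rw [he, ← Complex.exp_nat_mul]
      congr 1
      simp [z]
      ring
    have hc : ((Real.cos (Real.pi * x) : ℝ) : ℂ) = (e + e⁻¹) / 2 := by
      rw [Complex.ofReal_cos, Complex.cos, he, ← Complex.exp_neg]
      push_cast
      ring_nf
    have hsn : ((Real.sin (Real.pi * x) : ℝ) : ℂ) = (e⁻¹ - e) * Complex.I / 2 := by
      rw [Complex.ofReal_sin, Complex.sin, he, ← Complex.exp_neg]
      push_cast
      ring_nf
    simp only [F]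
    rw [hqe] at hq1 ⊢
    push_cast only [Complex.ofReal_div, Complex.ofReal_mul, Complex.ofReal_pow]
    rw [hc, hsn]
    have hI : Complex.I ^ 2 = -1 := Complex.I_sq
    have h1 : (e⁻¹ - e) * Complex.I / 2 = (1 - e ^ 2) * Complex.I / (2 * e) := by
      field_simp
    have h2 : (e + e⁻¹) / 2 = (1 + e ^ 2) / (2 * e) := by
      field_simp
      ring
    rw [h1, h2]
    have hI0 := Complex.I_ne_zero
    have hI6 : Complex.I ^ 6 = -1 := by
      rw [show 6 = 2 * 3 by norm_num, pow_mul, hI]; norm_num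
    field_simp
    ring_nf
    try simp only [hI6]
    try ring_nf
  rw [← hF, ← hlim]
  exact hsum.hasSum

lemma aux_res (m : ℕ) (hm : 2 ≤ m) (a : ℕ) (ha : a ∈ Finset.Icc 1 (m - 1)) :
    HasSum (fun n : ℤ => if n % (2 * m) = (a : ℤ) then 1 / (n : ℂ) ^ 3 else 0)
      ((Real.pi ^ 3 / (4 * (m : ℝ) ^ 3) *
        (Real.sin (a * Real.pi / m) / (1 - Real.cos (a * Real.pi / m)) ^ 2) : ℝ) : ℂ) := by
  rw [Finset.mem_Icc] at ha
  obtain ⟨ha1, ha2⟩ := ha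
  have hmR : (0 : ℝ) < m := by positivity
  have haR : (0 : ℝ) < a := by exact_mod_cast ha1
  have ham : (a : ℝ) < m := by
    have : a < m := by omega
    exact_mod_cast this
  have hx0 : 0 < (a : ℝ) / (2 * m) := by positivity
  have hx1 : (a : ℝ) / (2 * m) < 1 := by
    rw [div_lt_one (by positivity)]; linarith
  have h := aux_int _ hx0 hx1
  have hs : Real.sin (Real.pi * (a / (2 * m))) ≠ 0 := by
    apply ne_of_gt
    apply Real.sin_pos_of_pos_of_lt_pi
    · positivity
    · nlinarith [Real.pi_pos]
  have hinj : Function.Injective (fun k : ℤ => (a : ℤ) + 2 * m * k) := by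
    intro k l hkl
    have h2 : (2 * m : ℤ) * k = 2 * m * l := by simpa using hkl
    exact mul_left_cancel₀ (by positivity) h2
  rw [← hinj.hasSum_iff]
  · have h' := h.mul_left ((1 / (2 * m) ^ 3 : ℂ))
    refine (congrArg₂ (fun f s => HasSum f s) ?_ ?_ : _ = _).mpr h'
    · funext k
      have : ((a : ℤ) + 2 * m * k) % (2 * m) = a := by
        rw [Int.add_mul_emod_self_left]
        apply Int.emod_eq_of_lt <;> omega
      simp only [Function.comp, this, if_true]
      have hmC : (m : ℂ) ≠ 0 := by exact_mod_cast hmR.ne'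
      rw [div_mul_div_comm, ← mul_pow, one_mul]
      congr 2
      push_cast
      field_simp
    · rw [show (a * Real.pi / m : ℝ) = 2 * (Real.pi * (a / (2 * m))) by field_simp]
      rw [Real.sin_two_mul, Real.cos_two_mul, Real.cos_sq']
      have : (1 - (2 * (1 - Real.sin (Real.pi * (a / (2 * m))) ^ 2) - 1)) =
        2 * Real.sin (Real.pi * (a / (2 * m))) ^ 2 := by ring
      rw [this, show (1 / (2 * m) ^ 3 : ℂ) = ((1 / (2 * m) ^ 3 : ℝ) : ℂ) by push_cast; rfl,
        ← Complex.ofReal_mul]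
      congr 1
      field_simp
      ring
  · intro n hn
    rw [if_neg]
    intro h3
    apply hn
    refine ⟨n / (2 * m), ?_⟩
    have := Int.emod_add_mul_ediv n (2 * m)
    simp only
    rw [← h3]
    exact this

/-- Formula (1.4)/(3.5): for `m ≥ 2`,
`L(3,χ_2m) = (π³/(4m³)) · Σ_(a=1)^(m-1) sin(aπ/m)/(1 - cos(aπ/m))²`. -/
theorem lseries_chi2m_three (m : ℕ) (hm : 2 ≤ m) :
    ∑' n : ℕ, chi2m m (n + 1) / ((n : ℂ) + 1) ^ 3 =
      ((((Real.pi ^ 3 / (4 * (m : ℝ) ^ 3)) *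
        ∑ a ∈ Finset.Icc 1 (m - 1),
          Real.sin (a * Real.pi / m) / (1 - Real.cos (a * Real.pi / m)) ^ 2 : ℝ)) : ℂ) := by
  have key := hasSum_sum (fun a ha => aux_res m hm a ha)
  have hg : ∀ n : ℤ, (∑ a ∈ Finset.Icc 1 (m - 1),
      if n % (2 * m) = (a : ℤ) then 1 / (n : ℂ) ^ 3 else 0) =
      if 1 ≤ n % (2 * m) ∧ n % (2 * m) < m then 1 / (n : ℂ) ^ 3 else 0 := by
    intro n
    have h0 : 0 ≤ n % (2 * m) := Int.emod_nonneg _ (by positivity)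
    obtain ⟨b, hb⟩ := Int.eq_ofNat_of_zero_le h0
    rw [hb]
    simp only [Nat.cast_inj]
    rw [Finset.sum_ite_eq]
    congr 1
    rw [Finset.mem_Icc]
    apply propext
    omega
  simp only [hg] at key
  have k2 := key.nat_add_neg
  simp only [Int.cast_zero, Int.zero_emod, ne_eq, OfNat.ofNat_ne_zero, not_false_eq_true, zero_pow,
    div_zero, ite_self, add_zero] at k2
  have k3 := (hasSum_nat_add_iff' 1).mpr k2
  rw [Finset.mul_sum, Complex.ofReal_sum]
  simp only [Finset.range_one, Finset.sum_singleton, Nat.cast_zero, neg_zero, Int.zero_emod,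
    Int.cast_zero, ne_eq, OfNat.ofNat_ne_zero, not_false_eq_true, zero_pow,
    div_zero, ite_self, add_zero, sub_zero] at k3
  rw [← k3.tsum_eq]
  congr 1
  funext n
  have hM : (0 : ℤ) < 2 * m := by positivity
  have h0 : 0 ≤ ((n : ℤ) + 1) % (2 * m) := Int.emod_nonneg _ hM.ne'
  have h1 : ((n : ℤ) + 1) % (2 * m) < 2 * m := Int.emod_lt_of_pos _ hM
  have hneg : (-((n : ℤ) + 1)) % (2 * m) =
      if ((n : ℤ) + 1) % (2 * m) = 0 then 0 else 2 * m - ((n : ℤ) + 1) % (2 * m) := by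
    split_ifs with hd
    · exact Int.emod_eq_zero_of_dvd ((dvd_neg).mpr (Int.dvd_of_emod_eq_zero hd))
    · have e := Int.emod_add_mul_ediv ((n : ℤ) + 1) (2 * m)
      have : -((n : ℤ) + 1) = (2 * m - ((n : ℤ) + 1) % (2 * m)) +
          2 * m * (-1 - ((n : ℤ) + 1) / (2 * m)) := by linear_combination e
      rw [this, Int.add_mul_emod_self_left]
      apply Int.emod_eq_of_lt <;> omega
  have hodd : (-((n : ℂ) + 1)) ^ 3 = -((n : ℂ) + 1) ^ 3 := by ring
  simp only [chi2m]
  push_cast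
  rw [hneg, hodd]
  generalize ((n : ℤ) + 1) % (2 * m) = r at *
  by_cases c0 : r = 0
  · simp [c0]
  by_cases c1 : r < m
  · rw [if_neg c0, if_pos c1, if_pos (by omega), if_neg c0, if_neg (by omega)]
    simp
  by_cases c2 : r = m
  · rw [if_neg c0, if_neg c1, if_pos c2, if_neg (by omega), if_neg c0, if_neg (by omega)]
    simp
  · rw [if_neg c0, if_neg c1, if_neg c2, if_neg (by omega), if_neg c0, if_pos (by omega)]
    rw [zero_add, div_neg, neg_div]
end

section
/- The L-series L(3,χ_6) = Σ_{n=1}^∞ χ_6(n)/n³ = (1 + 1/2³ − 1/4³ − 1/5³) + (1/7³ + 1/8³ − 1/10³ − 1/11³) + ⋯ equals 5√3·π³/243. -/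
theorem bern3_sixth : (Polynomial.bernoulli 3).eval (1 / 6 : ℚ) = 5 / 108 := by
  simp_rw [Polynomial.bernoulli, Finset.sum_range_succ, Polynomial.eval_add,
    Polynomial.eval_monomial]
  rw [Finset.sum_range_zero, Polynomial.eval_zero, zero_add, bernoulli_one]
  rw [bernoulli_eq_bernoulli'_of_ne_one zero_ne_one, bernoulli'_zero,
    bernoulli_eq_bernoulli'_of_ne_one (by decide : 2 ≠ 1), bernoulli'_two,
    bernoulli_eq_bernoulli'_of_ne_one (by decide : 3 ≠ 1), bernoulli'_three]
  norm_num [Nat.choose]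

theorem sin_sum_sixth :
    HasSum (fun n : ℕ => (1 : ℝ) / (n : ℝ) ^ 3 * Real.sin (2 * Real.pi * n * (1 / 6)))
      (5 * Real.pi ^ 3 / 162) := by
  have h := hasSum_one_div_nat_pow_mul_sin one_ne_zero
    (⟨by norm_num, by norm_num⟩ : (1 / 6 : ℝ) ∈ Set.Icc (0 : ℝ) 1)
  refine (?_ : _ = 5 * Real.pi ^ 3 / 162) ▸ h
  have : (1 / 6 : ℝ) = (algebraMap ℚ ℝ) (1 / 6 : ℚ) := by simp
  rw [this, mul_pow, Polynomial.eval_map, Polynomial.eval₂_at_apply,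
    (by decide : 2 * 1 + 1 = 3), bern3_sixth]
  simp [Nat.factorial]
  ring

theorem sin_add_period (k r : ℕ) :
    Real.sin (2 * Real.pi * ((6 * k + r : ℕ) : ℝ) * (1 / 6)) = Real.sin (r * (Real.pi / 3)) := by
  rw [← Real.sin_add_nat_mul_two_pi (r * (Real.pi / 3)) k]
  congr 1
  push_cast
  ring

theorem chi_eq_sin (n : ℕ) :
    chi2m 3 (n : ℤ) =
      ((2 / Real.sqrt 3 * Real.sin (2 * Real.pi * n * (1 / 6)) : ℝ) : ℂ) := by
  have h3 : Real.sqrt 3 ≠ 0 := by positivity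
  obtain ⟨k, r, hr, rfl⟩ : ∃ k r : ℕ, r < 6 ∧ n = 6 * k + r :=
    ⟨n / 6, n % 6, Nat.mod_lt _ (by norm_num), (Nat.div_add_mod n 6).symm⟩
  rw [sin_add_period]
  have hm : ((6 * k + r : ℕ) : ℤ) % (2 * (3 : ℕ)) = r := by push_cast; omega
  unfold chi2m
  simp only [hm]
  have s2 : Real.sin (2 * (Real.pi / 3)) = Real.sqrt 3 / 2 := by
    rw [show 2 * (Real.pi / 3) = Real.pi - Real.pi / 3 by ring, Real.sin_pi_sub,
      Real.sin_pi_div_three]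
  have s3 : Real.sin (3 * (Real.pi / 3)) = 0 := by
    rw [show 3 * (Real.pi / 3) = Real.pi by ring, Real.sin_pi]
  have s4 : Real.sin (4 * (Real.pi / 3)) = -(Real.sqrt 3 / 2) := by
    rw [show 4 * (Real.pi / 3) = Real.pi / 3 + Real.pi by ring, Real.sin_add_pi,
      Real.sin_pi_div_three]
  have s5 : Real.sin (5 * (Real.pi / 3)) = -(Real.sqrt 3 / 2) := by
    rw [show 5 * (Real.pi / 3) = 2 * (Real.pi / 3) + Real.pi by ring, Real.sin_add_pi, s2]
  have e : 2 / Real.sqrt 3 * (Real.sqrt 3 / 2) = 1 := by field_simp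
  interval_cases r
  · simp
  · rw [Nat.cast_one (R := ℝ), one_mul, Real.sin_pi_div_three, e]; norm_num
  · rw [Nat.cast_ofNat (R := ℝ), s2, e]; norm_num
  · rw [Nat.cast_ofNat (R := ℝ), s3]; norm_num
  · rw [Nat.cast_ofNat (R := ℝ), s4, mul_neg, e]; norm_num
  · rw [Nat.cast_ofNat (R := ℝ), s5, mul_neg, e]; norm_num

/-- `L(3,χ_6) = Σ_(n=1)^∞ χ_6(n)/n^3` evaluated in closed form. -/
theorem lseries_chi6_three :
    ∑' n : ℕ, chi2m 3 (n + 1) / ((n : ℂ) + 1) ^ 3 =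
      ((5 * Real.sqrt 3 * Real.pi ^ 3 / 243 : ℝ) : ℂ) := by
  have h := (sin_sum_sixth.mul_left (2 / Real.sqrt 3))
  rw [← hasSum_nat_add_iff' 1] at h
  have h2 := (Complex.hasSum_ofReal.mpr h).tsum_eq
  have hv : 2 / Real.sqrt 3 * (5 * Real.pi ^ 3 / 162) = 5 * Real.sqrt 3 * Real.pi ^ 3 / 243 := by
    have h3 : Real.sqrt 3 ≠ 0 := by positivity
    have h4 : Real.sqrt 3 ^ 2 = 3 := Real.sq_sqrt (by norm_num)
    field_simp
    rw [h4]
    norm_num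
  rw [Finset.sum_range_one, Nat.cast_zero, mul_zero, zero_mul, Real.sin_zero, mul_zero, mul_zero,
    sub_zero, hv] at h2
  rw [← h2]
  refine tsum_congr fun n => ?_
  have hc := chi_eq_sin (n + 1)
  push_cast at hc ⊢
  rw [hc]
  ring
end

section
/- The L-series L(3,χ_8) = Σ_{n=1}^∞ χ_8(n)/n³ = (1 + 1/2³ + 1/3³ − 1/5³ − 1/6³ − 1/7³) + (1/9³ + 1/10³ + 1/11³ − 1/13³ − 1/14³ − 1/15³) + ⋯ equals π³(6√2 + 1)/256. -/
lemma aux_bern (x : ℝ) : (Polynomial.map (algebraMap ℚ ℝ) (Polynomial.bernoulli 3)).eval x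
    = x ^ 3 - 3 / 2 * x ^ 2 + x / 2 := by
  rw [Polynomial.bernoulli]
  simp [Finset.sum_range_succ, bernoulli_one, bernoulli_eq_bernoulli'_of_ne_one,
    bernoulli'_three, Nat.choose, Polynomial.eval_monomial]
  ring

lemma aux_coeff (n : ℕ) : chi2m 4 n =
    (((Real.sqrt 2 + 1) / 2 * Real.sin (2 * Real.pi * n * (1 / 8)) +
      (Real.sqrt 2 - 1) / 2 * Real.sin (2 * Real.pi * n * (3 / 8)) : ℝ) : ℂ) := by
  have h2 : Real.sqrt 2 * Real.sqrt 2 = 2 := Real.mul_self_sqrt (by norm_num)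
  have key : ∀ q r : ℕ, n = r + 8 * q →
      Real.sin (2 * Real.pi * n * (1 / 8)) = Real.sin (r * (Real.pi / 4)) ∧
      Real.sin (2 * Real.pi * n * (3 / 8)) = Real.sin (3 * (r * (Real.pi / 4))) := by
    intro q r h
    subst h
    constructor
    · rw [← Real.sin_add_nat_mul_two_pi (r * (Real.pi / 4)) q]; congr 1; push_cast; ring
    · rw [← Real.sin_add_nat_mul_two_pi (3 * (r * (Real.pi / 4))) (3 * q)]; congr 1; push_cast; ring
  obtain ⟨k1, k3⟩ := key (n / 8) (n % 8) (by omega)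
  rw [k1, k3, Real.sin_three_mul]
  have hr : n % 8 < 8 := Nat.mod_lt _ (by norm_num)
  have hc : ((n : ℤ) % (2 * ((4 : ℕ) : ℤ))) = ((n % 8 : ℕ) : ℤ) := by push_cast; norm_num
  unfold chi2m
  simp only [hc]
  generalize n % 8 = r at hr
  have s1 : Real.sin (Real.pi / 4) = Real.sqrt 2 / 2 := Real.sin_pi_div_four
  have s3 : Real.sin (3 * (Real.pi / 4)) = Real.sqrt 2 / 2 := by
    rw [← s1, ← Real.sin_pi_sub]; congr 1; ring
  have s2 : Real.sin (2 * (Real.pi / 4)) = 1 := by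
    rw [← Real.sin_pi_div_two]; congr 1; ring
  have s4 : Real.sin (4 * (Real.pi / 4)) = 0 := by
    rw [← Real.sin_pi]; congr 1; ring
  have s5 : Real.sin (5 * (Real.pi / 4)) = - (Real.sqrt 2 / 2) := by
    rw [← s1, ← Real.sin_add_pi]; congr 1; ring
  have s6 : Real.sin (6 * (Real.pi / 4)) = - 1 := by
    rw [← s2, ← Real.sin_add_pi]; congr 1; ring
  have s7 : Real.sin (7 * (Real.pi / 4)) = - (Real.sqrt 2 / 2) := by
    rw [← s3, ← Real.sin_add_pi]; congr 1; ring
  have h2C : (Real.sqrt 2 : ℂ) * (Real.sqrt 2 : ℂ) = 2 := by exact_mod_cast h2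
  clear key k1 k3 hc
  interval_cases r <;> norm_num [s1, s2, s3, s4, s5, s6, s7] <;> norm_cast <;> push_cast <;>
    clear s1 s2 s3 s4 s5 s6 s7 h2 <;> grind

/-- `L(3,χ_8) = Σ_(n=1)^∞ χ_8(n)/n^3` evaluated in closed form. -/
theorem lseries_chi8_three :
    ∑' n : ℕ, chi2m 4 (n + 1) / ((n : ℂ) + 1) ^ 3 =
      ((Real.pi ^ 3 * (6 * Real.sqrt 2 + 1) / 256 : ℝ) : ℂ) := by
  have h1 := hasSum_one_div_nat_pow_mul_sin (k := 1) one_ne_zero (x := 1 / 8)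
    (by constructor <;> norm_num)
  have h3 := hasSum_one_div_nat_pow_mul_sin (k := 1) one_ne_zero (x := 3 / 8)
    (by constructor <;> norm_num)
  have h := (h1.mul_left ((Real.sqrt 2 + 1) / 2)).add (h3.mul_left ((Real.sqrt 2 - 1) / 2))
  rw [← hasSum_nat_add_iff' 1] at h
  have hC := (Complex.hasSum_ofReal).2 h
  refine Eq.trans ?_ (hC.tsum_eq.trans ?_)
  · refine tsum_congr fun n => ?_
    have := aux_coeff (n + 1)
    push_cast at this ⊢
    rw [this]
    ring
  · congr 1
    rw [show 2 * 1 + 1 = 3 from rfl, aux_bern, aux_bern]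
    have h2 : Real.sqrt 2 * Real.sqrt 2 = 2 := Real.mul_self_sqrt (by norm_num)
    norm_num [Nat.factorial]
    ring
end

section
/- The L-series L(3,χ_12) = Σ_{n=1}^∞ χ_12(n)/n³ = (1 + 1/2³ + 1/3³ + 1/4³ + 1/5³ − 1/7³ − 1/8³ − 1/9³ − 1/10³ − 1/11³) + (1/13³ + ⋯ + 1/17³ − 1/19³ − ⋯ − 1/23³) + ⋯ equals π³(20√3 + 261)/7776. -/
theorem g_per (q r : ℕ) : Real.sin (((12 * q + r : ℕ) : ℝ) * (Real.pi / 6)) =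
    Real.sin ((r : ℝ) * (Real.pi / 6)) := by
  rw [← Real.sin_add_nat_mul_two_pi ((r : ℝ) * (Real.pi / 6)) q]
  congr 1; push_cast; ring

theorem g_small : Real.sin (1 * (Real.pi / 6)) = 1 / 2 ∧
    Real.sin (2 * (Real.pi / 6)) = √3 / 2 ∧ Real.sin (3 * (Real.pi / 6)) = 1 ∧
    Real.sin (4 * (Real.pi / 6)) = √3 / 2 ∧ Real.sin (5 * (Real.pi / 6)) = 1 / 2 ∧
    Real.sin (6 * (Real.pi / 6)) = 0 := by
  refine ⟨?_, ?_, ?_, ?_, ?_, ?_⟩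
  · rw [one_mul, Real.sin_pi_div_six]
  · rw [← Real.sin_pi_div_three]; congr 1; ring
  · rw [← Real.sin_pi_div_two]; congr 1; ring
  · rw [← Real.sin_pi_div_three, ← Real.sin_pi_sub (Real.pi / 3)]; congr 1; ring
  · rw [← Real.sin_pi_div_six, ← Real.sin_pi_sub (Real.pi / 6)]; congr 1; ring
  · rw [← Real.sin_pi]; congr 1; ring

theorem g_half (x : ℝ) (y : ℝ) (h : x = y + 6) :
    Real.sin (x * (Real.pi / 6)) = - Real.sin (y * (Real.pi / 6)) := by
  rw [← Real.sin_add_pi, h]; congr 1; ring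

theorem chi_eq (n : ℕ) : chi2m 6 (n : ℤ) =
    (((2 + √3) / 3 * Real.sin (((n * 1 : ℕ) : ℝ) * (Real.pi / 6))
      + 1 / 3 * Real.sin (((n * 3 : ℕ) : ℝ) * (Real.pi / 6))
      + (2 - √3) / 3 * Real.sin (((n * 5 : ℕ) : ℝ) * (Real.pi / 6)) : ℝ) : ℂ) := by
  have hr : n % 12 < 12 := Nat.mod_lt _ (by norm_num)
  have key : ∀ k : ℕ, Real.sin (((n * k : ℕ) : ℝ) * (Real.pi / 6)) =
      Real.sin (((((n % 12) * k) % 12 : ℕ) : ℝ) * (Real.pi / 6)) := by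
    intro k
    have h : n * k = 12 * (n * k / 12) + ((n % 12) * k) % 12 := by
      rw [Nat.mod_mul_mod]; exact (Nat.div_add_mod _ _).symm
    rw [h, g_per]
  rw [key 1, key 3, key 5]
  have hm : ((n : ℤ) % (2 * ((6 : ℕ) : ℤ))) = ((n % 12 : ℕ) : ℤ) := by push_cast; norm_num
  unfold chi2m
  simp only [hm]
  obtain ⟨h1, h2, h3, h4, h5, h6⟩ := g_small
  have h7 := g_half 7 1 (by norm_num)
  have h8 := g_half 8 2 (by norm_num)
  have h9 := g_half 9 3 (by norm_num)
  have h10 := g_half 10 4 (by norm_num)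
  have h11 := g_half 11 5 (by norm_num)
  rw [h1] at h7; rw [h2] at h8; rw [h3] at h9; rw [h4] at h10; rw [h5] at h11
  have hs : √3 * √3 = (3 : ℝ) := Real.mul_self_sqrt (by norm_num)
  have tr : ∀ (c : ℂ) (a b : ℝ), c = (a : ℂ) → a = b → c = (b : ℂ) := by
    rintro c a b rfl rfl; rfl
  generalize n % 12 = r at hr
  interval_cases r <;>
    first
    | (refine tr _ 0 _ (by norm_num) ?_
       norm_num only [Nat.cast_ofNat, Nat.cast_one, Nat.cast_zero, h1, h2, h3, h4, h5, h6, h7, h8, h9, h10, h11, zero_mul, Real.sin_zero]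
       done)
    | (refine tr _ 0 _ (by norm_num) ?_
       norm_num only [Nat.cast_ofNat, Nat.cast_one, Nat.cast_zero, h1, h2, h3, h4, h5, h6, h7, h8, h9, h10, h11, zero_mul, Real.sin_zero]
       linarith)
    | (refine tr _ 1 _ (by norm_num) ?_
       norm_num only [Nat.cast_ofNat, Nat.cast_one, Nat.cast_zero, h1, h2, h3, h4, h5, h6, h7, h8, h9, h10, h11, zero_mul, Real.sin_zero]
       linarith)
    | (refine tr _ (-1) _ (by norm_num) ?_
       norm_num only [Nat.cast_ofNat, Nat.cast_one, Nat.cast_zero, h1, h2, h3, h4, h5, h6, h7, h8, h9, h10, h11, zero_mul, Real.sin_zero]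
       linarith)

theorem bern3 (x : ℝ) : (Polynomial.map (algebraMap ℚ ℝ) (Polynomial.bernoulli 3)).eval x
    = x ^ 3 - 3 / 2 * x ^ 2 + 1 / 2 * x := by
  have h2 : bernoulli 2 = 1 / 6 := by
    rw [bernoulli_eq_bernoulli'_of_ne_one (by decide), bernoulli'_two]
  have h3 : bernoulli 3 = 0 := by
    rw [bernoulli_eq_bernoulli'_of_ne_one (by decide), bernoulli'_three]
  simp [Polynomial.bernoulli_def, Finset.sum_range_succ, h2, h3]
  ring

theorem sinSum (k : ℕ) (hk : k ≤ 12) :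
    HasSum (fun n : ℕ => 1 / (n : ℝ) ^ 3 * Real.sin (((n * k : ℕ) : ℝ) * (Real.pi / 6)))
      (2 * Real.pi ^ 3 / 3 * (((k : ℝ) / 12) ^ 3 - 3 / 2 * ((k : ℝ) / 12) ^ 2
        + 1 / 2 * ((k : ℝ) / 12))) := by
  have hk' : (k : ℝ) ≤ 12 := by exact_mod_cast hk
  have h := hasSum_one_div_nat_pow_mul_sin one_ne_zero (x := (k : ℝ) / 12)
    ⟨by positivity, by rw [div_le_one (by norm_num)]; exact hk'⟩
  rw [show 2 * 1 + 1 = 3 from rfl, bern3] at h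
  convert! h using 1
  · ext n
    congr 2
    push_cast; ring
  · rw [show Nat.factorial 3 = 6 from rfl]
    push_cast
    ring

/-- `L(3,χ_12) = Σ_(n=1)^∞ χ_12(n)/n^3` evaluated in closed form. -/
theorem lseries_chi12_three :
    ∑' n : ℕ, chi2m 6 (n + 1) / ((n : ℂ) + 1) ^ 3 =
      ((Real.pi ^ 3 * (20 * Real.sqrt 3 + 261) / 7776 : ℝ) : ℂ) := by
  have h := ((((sinSum 1 (by norm_num)).mul_left ((2 + √3) / 3)).add
    ((sinSum 3 (by norm_num)).mul_left (1 / 3))).add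
    ((sinSum 5 (by norm_num)).mul_left ((2 - √3) / 3)))
  have h2 := (hasSum_nat_add_iff' 1).mpr h
  have h3 := Complex.hasSum_ofReal.mpr h2
  have h4 := h3.tsum_eq
  refine Eq.trans (tsum_congr fun n => ?_) (h4.trans ?_)
  · have := chi_eq (n + 1)
    rw [show ((n : ℤ) + 1) = ((n + 1 : ℕ) : ℤ) by push_cast; rfl, this]
    push_cast
    ring
  · congr 1
    simp
    ring
end

section
/- The L-series L(3,f_8) = Σ_{n=1}^∞ f_8(n)/n³ = (1 + 1/3³ − 1/5³ − 1/7³) + (1/9³ + 1/11³ − 1/13³ − 1/15³) + ⋯ equals 3√2·π³/128. -/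
/-- The symmetric function `f_{4m}` mod `4m`: value `0` on even residues, `1` on odd
residues `1,…,2m-1`, and `-1` on odd residues `2m+1,…,4m-1`. -/
noncomputable def f4m (m : ℕ) : ℤ → ℂ := fun n =>
  let a := n % (4 * m)
  if a % 2 = 0 then 0
  else if a < 2 * m then 1
  else -1

theorem f8_aux_sin (r q : ℕ) (c : ℕ) :
    Real.sin (2 * Real.pi * ((8 * q + r : ℕ) : ℝ) * (c / 8)) = Real.sin (r * c * (Real.pi / 4)) := by
  have : 2 * Real.pi * ((8 * q + r : ℕ) : ℝ) * (c / 8)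
      = r * c * (Real.pi / 4) + ((q * c : ℕ) : ℝ) * (2 * Real.pi) := by
    push_cast; ring
  rw [this, Real.sin_add_nat_mul_two_pi]

theorem f8_aux_poly (x : ℚ) : (Polynomial.bernoulli 3).eval x = x ^ 3 - 3 / 2 * x ^ 2 + x / 2 := by
  simp_rw [Polynomial.bernoulli, Finset.sum_range_succ, Polynomial.eval_add,
    Polynomial.eval_monomial]
  rw [Finset.sum_range_zero, Polynomial.eval_zero, zero_add, bernoulli_one]
  rw [bernoulli_eq_bernoulli'_of_ne_one zero_ne_one, bernoulli'_zero,
    bernoulli_eq_bernoulli'_of_ne_one (by decide : 2 ≠ 1), bernoulli'_two,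
    bernoulli_eq_bernoulli'_of_ne_one (by decide : 3 ≠ 1), bernoulli'_three]
  norm_num [Nat.choose]
  ring

theorem f8_aux_val (x : ℚ) (h0 : 0 ≤ x) (h1 : x ≤ 1) :
    HasSum (fun n : ℕ => 1 / (n : ℝ) ^ 3 * Real.sin (2 * Real.pi * n * (x : ℝ)))
      ((2 * Real.pi) ^ 3 / 12 * ((x ^ 3 - 3 / 2 * x ^ 2 + x / 2 : ℚ) : ℝ)) := by
  have h := hasSum_one_div_nat_pow_mul_sin one_ne_zero
    (x := (x : ℝ)) ⟨by exact_mod_cast h0, by exact_mod_cast h1⟩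
  convert! h using 1
  have : (x : ℝ) = (algebraMap ℚ ℝ) x := by simp
  rw [this, Polynomial.eval_map, Polynomial.eval₂_at_apply, (by decide : 2 * 1 + 1 = 3),
    f8_aux_poly]
  simp [Nat.factorial]
  left
  ring

theorem f8_aux_f (n : ℕ) : f4m 2 (n : ℤ) =
    (((Real.sin (2 * Real.pi * n * ((1 : ℕ) / 8)) + Real.sin (2 * Real.pi * n * ((3 : ℕ) / 8)))
      / Real.sqrt 2 : ℝ) : ℂ) := by
  have e1 : Real.sin (Real.pi / 4) = Real.sqrt 2 / 2 := Real.sin_pi_div_four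
  have c1 : Real.cos (Real.pi / 4) = Real.sqrt 2 / 2 := Real.cos_pi_div_four
  have hs : Real.sqrt 2 ≠ 0 := by positivity
  have hs2 : Real.sqrt 2 ^ 2 = 2 := Real.sq_sqrt (by norm_num)
  obtain ⟨q, r, hr, rfl⟩ : ∃ q r, r < 8 ∧ n = 8 * q + r :=
    ⟨n / 8, n % 8, Nat.mod_lt _ (by norm_num), (Nat.div_add_mod n 8).symm⟩
  rw [f8_aux_sin, f8_aux_sin]
  have hm : (((8 * q + r : ℕ) : ℤ)) % (4 * (2 : ℕ)) = r := by push_cast; omega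
  simp only [f4m, hm]
  have sadd : ∀ k : ℕ, Real.sin ((k + 1 : ℕ) * (Real.pi / 4))
      = (Real.sin (k * (Real.pi / 4)) + Real.cos (k * (Real.pi / 4))) * (Real.sqrt 2 / 2) := by
    intro k; push_cast; rw [add_mul, one_mul, Real.sin_add, e1, c1]; ring
  have s4 : ∀ k : ℕ, Real.sin ((k + 4 : ℕ) * (Real.pi / 4)) = - Real.sin (k * (Real.pi / 4)) := by
    intro k
    rw [← Real.sin_add_pi]; congr 1; push_cast; ring
  have v0 : Real.sin ((0 : ℕ) * (Real.pi / 4)) = 0 := by simp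
  have v1 : Real.sin ((1 : ℕ) * (Real.pi / 4)) = Real.sqrt 2 / 2 := by simp
  have v2 : Real.sin ((2 : ℕ) * (Real.pi / 4)) = 1 := by
    rw [← Real.sin_pi_div_two]; congr 1; push_cast; ring
  have v3 : Real.sin ((3 : ℕ) * (Real.pi / 4)) = Real.sqrt 2 / 2 := by
    rw [← e1, ← Real.sin_pi_sub]; congr 1; push_cast; ring
  have key : ∀ k : ℕ, (r : ℝ) * (k : ℕ) * (Real.pi / 4) = ((r * k : ℕ) : ℝ) * (Real.pi / 4) := by
    intro k; push_cast; ring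
  rw [key, key]
  clear sadd key hm
  have hc : ((Real.sqrt 2 : ℝ) : ℂ) ≠ 0 := by exact_mod_cast hs
  interval_cases r <;> simp only [Nat.reduceMul, s4 0, s4 1, s4 2, s4 3, s4 4, s4 5, s4 6, s4 8, s4 11, s4 14, s4 17, s4 10, s4 7, s4 13, s4 9, v0, v1, v2, v3] <;> norm_num <;> field_simp <;> norm_num

/-- `L(3,f_8) = Σ_(n=1)^∞ f_8(n)/n^3` evaluated in closed form. -/
theorem lseries_f8_three :
    ∑' n : ℕ, f4m 2 (n + 1) / ((n : ℂ) + 1) ^ 3 =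
      ((3 * Real.sqrt 2 * Real.pi ^ 3 / 128 : ℝ) : ℂ) := by
  have hs : Real.sqrt 2 ≠ 0 := by positivity
  have hs2 : Real.sqrt 2 ^ 2 = 2 := Real.sq_sqrt (by norm_num)
  have h := ((f8_aux_val (1 / 8) (by norm_num) (by norm_num)).add
    (f8_aux_val (3 / 8) (by norm_num) (by norm_num))).div_const (Real.sqrt 2)
  rw [← hasSum_nat_add_iff' 1] at h
  have h' := Complex.hasSum_ofReal.mpr h
  refine (HasSum.tsum_eq (a := _) ?_)
  convert! h' using 1
  · funext n
    have := f8_aux_f (n + 1)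
    push_cast at this ⊢
    rw [this]
    ring
  · congr 1
    simp
    field_simp
    norm_num
end

section
/- The L-series L(3,f_12) = Σ_{n=1}^∞ f_12(n)/n³ = (1 + 1/3³ + 1/5³ − 1/7³ − 1/9³ − 1/11³) + (1/13³ + 1/15³ + 1/17³ − 1/19³ − 1/21³ − 1/23³) + ⋯ equals 29π³/864. -/
lemma f12_sin_vals (r : ℕ) (hr : r < 12) :
    (let s := Real.sin (r * (Real.pi / 6)); (3 * s - 4 * s ^ 3) * (4 / 3 * (1 - 2 * s ^ 2) + 1 / 3))
      = if r % 2 = 0 then 0 else if r < 6 then 1 else -1 := by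
  have h3 : Real.sqrt 3 ^ 2 = 3 := Real.sq_sqrt (by norm_num)
  have key : ∀ k : ℕ, k < 6 → (let s := Real.sin (k * (Real.pi / 6));
      (3 * s - 4 * s ^ 3) * (4 / 3 * (1 - 2 * s ^ 2) + 1 / 3))
      = if k % 2 = 0 then 0 else 1 := by
    intro k hk
    interval_cases k
    · simp
    · have : Real.sin ((1 : ℕ) * (Real.pi / 6)) = 1 / 2 := by simp
      rw [this]; norm_num
    · have : Real.sin ((2 : ℕ) * (Real.pi / 6)) = Real.sqrt 3 / 2 := by
        rw [← Real.sin_pi_div_three]; congr 1; push_cast; ring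
      rw [this]; simp only [div_pow, pow_succ, pow_zero] at *; norm_num
      left; linear_combination (-Real.sqrt 3 / 2) * h3
    · have : Real.sin ((3 : ℕ) * (Real.pi / 6)) = 1 := by
        rw [← Real.sin_pi_div_two]; congr 1; push_cast; ring
      rw [this]; norm_num
    · have : Real.sin ((4 : ℕ) * (Real.pi / 6)) = Real.sqrt 3 / 2 := by
        rw [← Real.sin_pi_div_three, ← Real.sin_pi_sub]; congr 1; push_cast; ring
      rw [this]; simp only [div_pow, pow_succ, pow_zero] at *; norm_num
      left; linear_combination (-Real.sqrt 3 / 2) * h3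
    · have : Real.sin ((5 : ℕ) * (Real.pi / 6)) = 1 / 2 := by
        rw [← Real.sin_pi_div_six, ← Real.sin_pi_sub]; congr 1; push_cast; ring
      rw [this]; norm_num
  by_cases h : r < 6
  · rw [key r h]; simp [h]
  · obtain ⟨k, rfl⟩ : ∃ k, r = k + 6 := ⟨r - 6, by omega⟩
    have hk := key k (by omega)
    have e : Real.sin ((k + 6 : ℕ) * (Real.pi / 6)) = - Real.sin (k * (Real.pi / 6)) := by
      rw [← Real.sin_add_pi]; congr 1; push_cast; ring
    have e2 : (k + 6) % 2 = k % 2 := by omega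
    simp only at hk
    simp only [e, e2, h, if_false]
    split_ifs at hk ⊢ <;> linear_combination -hk

lemma f12_sin (n : ℕ) :
    2 / 3 * Real.sin (2 * Real.pi * n * (1 / 12)) + 2 / 3 * Real.sin (2 * Real.pi * n * (5 / 12))
      + 1 / 3 * Real.sin (2 * Real.pi * n * (1 / 4))
      = if n % 12 % 2 = 0 then 0 else if n % 12 < 6 then 1 else -1 := by
  rw [← f12_sin_vals (n % 12) (Nat.mod_lt _ (by norm_num))]
  have e : Real.sin ((n % 12 : ℕ) * (Real.pi / 6)) = Real.sin (n * (Real.pi / 6)) := by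
    conv_rhs => rw [← Nat.mod_add_div n 12]
    rw [← Real.sin_add_nat_mul_two_pi _ (n / 12)]
    congr 1; push_cast; ring
  simp only [e]
  set x := (n : ℝ) * (Real.pi / 6) with hx
  have e1 : 2 * Real.pi * n * (1 / 12) = 3 * x - 2 * x := by rw [hx]; ring
  have e5 : 2 * Real.pi * n * (5 / 12) = 3 * x + 2 * x := by rw [hx]; ring
  have e3 : 2 * Real.pi * n * (1 / 4) = 3 * x := by rw [hx]; ring
  rw [e1, e5, e3, Real.sin_add, Real.sin_sub, Real.sin_three_mul, Real.cos_two_mul, Real.cos_sq']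
  ring

lemma f12_B3 (x : ℝ) :
    (Polynomial.map (algebraMap ℚ ℝ) (Polynomial.bernoulli (2 * 1 + 1))).eval x
      = x ^ 3 - 3 / 2 * x ^ 2 + 1 / 2 * x := by
  have h3 : bernoulli 3 = 0 := by
    rw [bernoulli_eq_bernoulli'_of_ne_one (by norm_num), bernoulli'_three]
  have c : Nat.choose 3 2 = 3 := rfl
  simp [Polynomial.bernoulli, Finset.sum_range_succ, h3, c, bernoulli_two,
    Polynomial.eval_monomial]
  ring

lemma f12_hasSum : HasSum (fun n : ℕ => 1 / (n : ℝ) ^ 3 *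
    (if n % 12 % 2 = 0 then (0 : ℝ) else if n % 12 < 6 then 1 else -1))
    (29 * Real.pi ^ 3 / 864) := by
  have h1 := hasSum_one_div_nat_pow_mul_sin one_ne_zero
    (show (1 / 12 : ℝ) ∈ Set.Icc (0 : ℝ) 1 by constructor <;> norm_num)
  have h5 := hasSum_one_div_nat_pow_mul_sin one_ne_zero
    (show (5 / 12 : ℝ) ∈ Set.Icc (0 : ℝ) 1 by constructor <;> norm_num)
  have h3 := hasSum_one_div_nat_pow_mul_sin one_ne_zero
    (show (1 / 4 : ℝ) ∈ Set.Icc (0 : ℝ) 1 by constructor <;> norm_num)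
  rw [f12_B3] at h1 h5 h3
  convert! ((h1.mul_left (2 / 3)).add (h5.mul_left (2 / 3))).add (h3.mul_left (1 / 3)) using 1
  · ext n
    rw [← f12_sin]
    ring
  · simp [Nat.factorial]; ring

/-- `L(3,f_12) = Σ_(n=1)^∞ f_12(n)/n^3` evaluated in closed form. -/
theorem lseries_f12_three :
    ∑' n : ℕ, f4m 3 (n + 1) / ((n : ℂ) + 1) ^ 3 =
      ((29 * Real.pi ^ 3 / 864 : ℝ) : ℂ) := by
  have h := (hasSum_nat_add_iff' 1).mpr f12_hasSum
  have h' := (Complex.hasSum_ofReal.mpr h).tsum_eq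
  simp only [Finset.sum_range_one, Nat.zero_mod, if_true, mul_zero, sub_zero] at h'
  rw [← h']
  congr 1
  ext n
  have e : f4m 3 (n + 1) = (((if (n + 1) % 12 % 2 = 0 then (0 : ℝ)
      else if (n + 1) % 12 < 6 then 1 else -1) : ℝ) : ℂ) := by
    have a : ((n : ℤ) + 1) % (4 * (3 : ℕ)) % 2 = 0 ↔ (n + 1) % 12 % 2 = 0 := by omega
    have b : ((n : ℤ) + 1) % (4 * (3 : ℕ)) < 2 * (3 : ℕ) ↔ (n + 1) % 12 < 6 := by omega
    simp only [f4m, a, b]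
    split_ifs <;> simp
  rw [e]
  push_cast
  ring
end

section
/- The L-series L(3,f_24) = Σ_{n=1}^∞ f_24(n)/n³ = (1 + 1/3³ + 1/5³ + ⋯ + 1/11³ − 1/13³ − 1/15³ − ⋯ − 1/23³) + (1/25³ + 1/27³ + ⋯ + 1/35³ − 1/37³ − ⋯ − 1/47³) + ⋯ equals (π³/62208)·[(2484 − 828√3)·√(2+√3) + 54√2]. -/
noncomputable def SS (k : ℕ) : ℝ := Real.sin (k * (Real.pi / 12))

lemma SS_add (k : ℕ) : SS (k + 12) = - SS k := by
  unfold SS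
  rw [← Real.sin_add_pi]; congr 1; push_cast; ring

lemma SS_red (q r : ℕ) : SS (12 * q + r) = (-1) ^ q * SS r := by
  induction q with
  | zero => simp
  | succ q ih =>
    rw [show 12 * (q + 1) + r = (12 * q + r) + 12 by ring, SS_add, ih]; ring

lemma SS_mod (k : ℕ) : SS k = (-1) ^ (k / 12) * SS (k % 12) := by
  conv_lhs => rw [← Nat.div_add_mod k 12]
  exact SS_red _ _

lemma SS_refl (k l : ℕ) (h : k + l = 12) : SS k = SS l := by
  unfold SS
  rw [← Real.sin_pi_sub]; congr 1
  have : (k : ℝ) + l = 12 := by exact_mod_cast h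
  rw [show (k : ℝ) = 12 - l by linarith]; ring

lemma S0 : SS 0 = 0 := by simp [SS]
lemma S2 : SS 2 = 1 / 2 := by
  unfold SS; rw [← Real.sin_pi_div_six]; congr 1; push_cast; ring
lemma S3 : SS 3 = √2 / 2 := by
  unfold SS; rw [← Real.sin_pi_div_four]; congr 1; push_cast; ring
lemma S4 : SS 4 = √3 / 2 := by
  unfold SS; rw [← Real.sin_pi_div_three]; congr 1; push_cast; ring
lemma S6 : SS 6 = 1 := by
  unfold SS; rw [← Real.sin_pi_div_two]; congr 1; push_cast; ring
lemma S1 : SS 1 = √2 * (√3 - 1) / 4 := by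
  unfold SS
  rw [show ((1 : ℕ) : ℝ) * (Real.pi / 12) = Real.pi / 3 - Real.pi / 4 by push_cast; ring,
    Real.sin_sub]
  simp; ring
lemma S5 : SS 5 = √2 * (√3 + 1) / 4 := by
  unfold SS
  rw [show ((5 : ℕ) : ℝ) * (Real.pi / 12) = Real.pi / 6 + Real.pi / 4 by push_cast; ring,
    Real.sin_add]
  simp; ring
lemma S7 : SS 7 = √2 * (√3 + 1) / 4 := by rw [SS_refl 7 5 rfl, S5]
lemma S8 : SS 8 = √3 / 2 := by rw [SS_refl 8 4 rfl, S4]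
lemma S9 : SS 9 = √2 / 2 := by rw [SS_refl 9 3 rfl, S3]
lemma S10 : SS 10 = 1 / 2 := by rw [SS_refl 10 2 rfl, S2]
lemma S11 : SS 11 = √2 * (√3 - 1) / 4 := by rw [SS_refl 11 1 rfl, S1]

noncomputable def gg (n : ℕ) : ℝ :=
  √2 * (√3 + 1) / 6 * (SS (n * 1) + SS (n * 11)) + √2 / 6 * (SS (n * 3) + SS (n * 9))
    + √2 * (√3 - 1) / 6 * (SS (n * 5) + SS (n * 7))

lemma gg_add (n : ℕ) : gg (n + 12) = - gg n := by
  unfold gg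
  simp only [add_mul, Nat.add_comm (n * _), SS_red]
  norm_num
  ring

lemma f_add (n : ℕ) : f4m 6 ((n + 12 : ℕ) : ℤ) = - f4m 6 (n : ℤ) := by
  simp only [f4m]
  push_cast
  split_ifs <;> first | omega | simp

lemma f_eq_gg (n : ℕ) : f4m 6 (n : ℤ) = (gg n : ℂ) := by
  induction n using Nat.strong_induction_on with
  | _ n ih =>
    by_cases h : 12 ≤ n
    · obtain ⟨k, rfl⟩ := Nat.exists_eq_add_of_le' h
      rw [f_add, gg_add, ih k (by omega)]; push_cast; rfl
    · have h2 : √2 ^ 2 = 2 := Real.sq_sqrt (by norm_num)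
      have h3 : √3 ^ 2 = 3 := Real.sq_sqrt (by norm_num)
      have key : ∀ x : ℝ, x = gg n → f4m 6 (n : ℤ) = (x : ℂ) → f4m 6 (n : ℤ) = (gg n : ℂ) := by
        rintro x rfl h; exact h
      have hn : n < 12 := by omega
      refine key (if n % 2 = 0 then 0 else 1) ?_ ?_
      · clear key ih h
        unfold gg
        rw [SS_mod (n * 1), SS_mod (n * 11), SS_mod (n * 3), SS_mod (n * 9), SS_mod (n * 5),
          SS_mod (n * 7)]
        interval_cases n <;>
          norm_num [S0, S1, S2, S3, S4, S5, S6, S7, S8, S9, S10, S11] <;>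
          ring_nf <;> norm_num [h2, h3]
      · clear key ih h
        interval_cases n <;> simp [f4m]

lemma hs (j : ℕ) (hj : j ≤ 24) : HasSum (fun n : ℕ => SS (n * j) / (n : ℝ) ^ 3)
    ((2 * Real.pi) ^ 3 / 12 * ((j / 24 : ℝ) ^ 3 - 3 / 2 * (j / 24 : ℝ) ^ 2 + (j / 24 : ℝ) / 2)) := by
  have hj' : (j : ℝ) ≤ 24 := by exact_mod_cast hj
  have := hasSum_one_div_nat_pow_mul_sin (k := 1) one_ne_zero (x := (j / 24 : ℝ))
    ⟨by positivity, by linarith⟩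
  convert this using 1
  · ext n
    unfold SS
    rw [div_eq_inv_mul, one_div]
    congr 2; push_cast; ring
  · simp [Polynomial.bernoulli, Finset.sum_range_succ, Polynomial.eval_add, Nat.factorial, Nat.choose,
      bernoulli_eq_bernoulli'_of_ne_one, bernoulli_one, bernoulli'_two, bernoulli'_three]
    ring

lemma hasSum_gg : HasSum (fun n : ℕ => gg n / (n : ℝ) ^ 3) 
    (Real.pi ^ 3 / 62208 * ((2484 - 828 * Real.sqrt 3) * Real.sqrt (2 + Real.sqrt 3) + 54 * Real.sqrt 2)) := by
  have h2 : √2 ^ 2 = 2 := Real.sq_sqrt (by norm_num)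
  have h3 : √3 ^ 2 = 3 := Real.sq_sqrt (by norm_num)
  have h : √(2 + √3) = √2 * (√3 + 1) / 2 := by
    rw [Real.sqrt_eq_iff_mul_self_eq (by positivity) (by positivity)]
    linear_combination (-1 : ℝ) * ((√3 + 1) ^ 2 / 4) * h2 - h3 / 2
  have := ((((hs 1 (by norm_num)).add (hs 11 (by norm_num))).mul_left (√2 * (√3 + 1) / 6)).add
    (((hs 3 (by norm_num)).add (hs 9 (by norm_num))).mul_left (√2 / 6))).add
    (((hs 5 (by norm_num)).add (hs 7 (by norm_num))).mul_left (√2 * (√3 - 1) / 6))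
  refine (congr_arg₂ HasSum ?_ ?_).to_iff.mp this
  · funext n; simp only [gg]; ring
  · rw [h]; push_cast; ring_nf
    rw [h3]; ring

theorem lseries_f24_three :
    ∑' n : ℕ, f4m 6 (n + 1) / ((n : ℂ) + 1) ^ 3 =
      ((Real.pi ^ 3 / 62208 * ((2484 - 828 * Real.sqrt 3) * Real.sqrt (2 + Real.sqrt 3) + 54 * Real.sqrt 2) : ℝ) : ℂ) := by
  have h := (hasSum_nat_add_iff' 1).mpr hasSum_gg
  have h' := (Complex.hasSum_ofReal.mpr h).tsum_eq
  simp only [Finset.range_one, Finset.sum_singleton, Nat.cast_zero, ne_eq, OfNat.ofNat_ne_zero,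
    not_false_eq_true, zero_pow, div_zero, sub_zero] at h'
  rw [← h']
  congr 1; ext n
  have := f_eq_gg (n + 1)
  push_cast at this ⊢
  rw [this]
end

section
/- The L-series L(5,χ_6) = Σ_{n=1}^∞ χ_6(n)/n⁵ = (1 + 1/2⁵ − 1/4⁵ − 1/5⁵) + (1/7⁵ + 1/8⁵ − 1/10⁵ − 1/11⁵) + ⋯ equals 17√3·π⁵/8748. -/
lemma bern5_aux : (Polynomial.bernoulli 5).eval (1 / 6 : ℚ) = -85 / 3888 := by
  have h3 : bernoulli 3 = 0 := by
    rw [bernoulli_eq_bernoulli'_of_ne_one (by norm_num), bernoulli'_three]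
  have h4 : bernoulli 4 = -1 / 30 := by
    rw [bernoulli_eq_bernoulli'_of_ne_one (by norm_num), bernoulli'_four]
  have h5 : bernoulli 5 = 0 := by
    rw [bernoulli_eq_bernoulli'_of_ne_one (by norm_num)]
    exact bernoulli'_eq_zero_of_odd (by decide) (by norm_num)
  have c1 : Nat.choose 5 2 = 10 := by decide
  have c2 : Nat.choose 5 3 = 10 := by decide
  have c3 : Nat.choose 5 4 = 5 := by decide
  simp only [Polynomial.bernoulli, Finset.sum_range_succ, Polynomial.eval_add,
    Polynomial.eval_monomial, h3, h4, h5, bernoulli_zero, bernoulli_one, bernoulli_two,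
    Finset.sum_range_zero, Polynomial.eval_zero, c1, c2, c3, Nat.choose_zero_right,
    Nat.choose_one_right, Nat.choose_self]
  norm_num

lemma chi_aux (n : ℕ) :
    ((Real.sin (2 * Real.pi * n * (1 / 6)) : ℝ) : ℂ) = (Real.sqrt 3 / 2 : ℝ) * chi2m 3 (n : ℤ) := by
  obtain ⟨q, r, hr, rfl⟩ : ∃ q r : ℕ, r < 6 ∧ n = r + 6 * q :=
    ⟨n / 6, n % 6, Nat.mod_lt _ (by norm_num), by omega⟩
  have h1 : Real.sin (2 * Real.pi * ((r + 6 * q : ℕ) : ℝ) * (1 / 6))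
      = Real.sin (r * (Real.pi / 3)) := by
    rw [← Real.sin_add_nat_mul_two_pi (r * (Real.pi / 3)) q]
    congr 1
    push_cast
    ring
  have h2 : (((r + 6 * q : ℕ) : ℤ)) % (2 * ((3 : ℕ) : ℤ)) = r := by
    push_cast; omega
  rw [h1]
  unfold chi2m
  simp only [h2]
  have s2 : Real.sin (2 * (Real.pi / 3)) = Real.sqrt 3 / 2 := by
    rw [← Real.sin_pi_div_three, ← Real.sin_pi_sub]; congr 1; ring
  have s4 : Real.sin (4 * (Real.pi / 3)) = -(Real.sqrt 3 / 2) := by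
    rw [← Real.sin_pi_div_three, ← Real.sin_add_pi]; congr 1; ring
  have s5 : Real.sin (5 * (Real.pi / 3)) = -(Real.sqrt 3 / 2) := by
    rw [← s2, ← Real.sin_add_pi]; congr 1; ring
  have s3 : Real.sin (3 * (Real.pi / 3)) = 0 := by
    rw [← Real.sin_pi]; congr 1; ring
  interval_cases r
  · simp
  · rw [Nat.cast_one, one_mul, Real.sin_pi_div_three]; norm_num
  · rw [Nat.cast_ofNat, s2]; norm_num
  · rw [Nat.cast_ofNat, s3]; norm_num
  · rw [Nat.cast_ofNat, s4]; norm_num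
  · rw [Nat.cast_ofNat, s5]; norm_num

/-- `L(5,χ_6) = Σ_(n=1)^∞ χ_6(n)/n^5` evaluated in closed form. -/
theorem lseries_chi6_five :
    ∑' n : ℕ, chi2m 3 (n + 1) / ((n : ℂ) + 1) ^ 5 =
      ((17 * Real.sqrt 3 * Real.pi ^ 5 / 8748 : ℝ) : ℂ) := by
  have h := hasSum_one_div_nat_pow_mul_sin (k := 2) (by norm_num) (x := 1 / 6)
    ⟨by norm_num, by norm_num⟩
  have e : (1 / 6 : ℝ) = (algebraMap ℚ ℝ) (1 / 6 : ℚ) := by simp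
  have hv : (Polynomial.map (algebraMap ℚ ℝ) (Polynomial.bernoulli (2 * 2 + 1))).eval (1 / 6 : ℝ)
      = -85 / 3888 := by
    rw [e, Polynomial.eval_map, Polynomial.eval₂_at_apply, (by decide : 2 * 2 + 1 = 5), bern5_aux]
    simp
  rw [hv] at h
  have h := (hasSum_nat_add_iff' 1).mpr h
  have h := (Complex.hasSum_ofReal.mpr h).mul_left (((2 * Real.sqrt 3 / 3 : ℝ)) : ℂ)
  have s3 : Real.sqrt 3 * Real.sqrt 3 = 3 := Real.mul_self_sqrt (by norm_num)
  have hs : ((Real.sqrt 3 : ℝ) : ℂ) * (Real.sqrt 3 : ℝ) = 3 := by exact_mod_cast s3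
  convert h.tsum_eq using 1
  · congr 1
    funext n
    rw [Complex.ofReal_mul, chi_aux]
    push_cast
    generalize chi2m 3 ((n : ℤ) + 1) = c
    linear_combination (-(1 / 3) * c / ((n : ℂ) + 1) ^ 5) * hs
  · rw [← Complex.ofReal_mul]
    congr 1
    simp [Nat.factorial]
    ring
end

section
/- The L-series L(5,χ_24) = Σ_{n=1}^∞ χ_24(n)/n⁵ = (1 + 1/2⁵ + ⋯ + 1/11⁵ − 1/13⁵ − ⋯ − 1/23⁵) + (1/25⁵ + ⋯ + 1/35⁵ − 1/37⁵ − ⋯ − 1/47⁵) + ⋯ equals (π⁵/35831808)·[(143460 − 47820√3)·√(2+√3) + 342√2 + 68√3 + 3675]. -/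
noncomputable def sTab : ℕ → ℝ
  | 0 => 0
  | 1 => (√2 * √3 - √2) / 4
  | 2 => 1 / 2
  | 3 => √2 / 2
  | 4 => √3 / 2
  | 5 => (√2 * √3 + √2) / 4
  | 6 => 1
  | 7 => (√2 * √3 + √2) / 4
  | 8 => √3 / 2
  | 9 => √2 / 2
  | 10 => 1 / 2
  | 11 => (√2 * √3 - √2) / 4
  | (k + 12) => - sTab k

theorem sin_tab (k : ℕ) : Real.sin (Real.pi * k / 12) = sTab k := by
  have h2 : Real.sin (Real.pi / 12) = (√2 * √3 - √2) / 4 := by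
    rw [show Real.pi / 12 = Real.pi / 3 - Real.pi / 4 by ring, Real.sin_sub]
    simp; ring
  have h5 : Real.sin (5 * Real.pi / 12) = (√2 * √3 + √2) / 4 := by
    rw [show 5 * Real.pi / 12 = Real.pi / 6 + Real.pi / 4 by ring, Real.sin_add]
    simp; ring
  have hs : ∀ x : ℝ, Real.sin (Real.pi - x) = Real.sin x := Real.sin_pi_sub
  induction k using sTab.induct with
  | case1 => simp [sTab]
  | case2 => simpa [sTab] using h2
  | case3 => rw [sTab, ← Real.sin_pi_div_six]; congr 1; push_cast; ring
  | case4 => rw [sTab, ← Real.sin_pi_div_four]; congr 1; push_cast; ring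
  | case5 => rw [sTab, ← Real.sin_pi_div_three]; congr 1; push_cast; ring
  | case6 => rw [sTab, ← h5]; congr 1; push_cast; ring
  | case7 => rw [sTab, ← Real.sin_pi_div_two]; congr 1; push_cast; ring
  | case8 => rw [sTab, ← h5, ← hs]; congr 1; push_cast; ring
  | case9 => rw [sTab, ← Real.sin_pi_div_three, ← hs]; congr 1; push_cast; ring
  | case10 => rw [sTab, ← Real.sin_pi_div_four, ← hs]; congr 1; push_cast; ring
  | case11 => rw [sTab, ← Real.sin_pi_div_six, ← hs]; congr 1; push_cast; ring
  | case12 => rw [sTab, ← h2, ← hs]; congr 1; push_cast; ring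
  | case13 k ih =>
    rw [sTab, ← ih, ← Real.sin_add_pi]; congr 1; push_cast; ring

theorem sTab_mod (k : ℕ) : sTab k = sTab (k % 24) := by
  rw [← sin_tab, ← sin_tab]
  conv_lhs => rw [← Nat.mod_add_div k 24]
  rw [← Real.sin_add_nat_mul_two_pi (Real.pi * ((k % 24 : ℕ) : ℝ) / 12) (k / 24)]
  congr 1; push_cast; ring

/-- finite sine expansion -/
theorem chi_expand (n : ℕ) : chi2m 12 (n : ℤ) = (((1 / 6 : ℝ) * (
      (√2 * √3 + √3 + √2 + 2) * sTab (1 * n) + (1 + √2) * sTab (3 * n)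
    + (√2 * √3 - √3 - √2 + 2) * sTab (5 * n) + (√2 * √3 + √3 - √2 - 2) * sTab (7 * n)
    + (√2 - 1) * sTab (9 * n) + (√2 * √3 - √3 + √2 - 2) * sTab (11 * n)) : ℝ) : ℂ) := by
  have ha : √2 ^ 2 = 2 := Real.sq_sqrt (by norm_num)
  have hb : √3 ^ 2 = 3 := Real.sq_sqrt (by norm_num)
  have hc : chi2m 12 (n : ℤ) = chi2m 12 ((n % 24 : ℕ) : ℤ) := by
    simp [chi2m]
  have hm : ∀ j : ℕ, sTab (j * n) = sTab ((j * (n % 24)) % 24) := by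
    intro j; rw [sTab_mod, Nat.mul_mod, Nat.mul_mod j (n % 24), Nat.mod_mod]
  rw [hc]
  simp only [hm]
  have hlt : n % 24 < 24 := Nat.mod_lt _ (by norm_num)
  generalize n % 24 = r at hlt
  have hA : ((√2 : ℝ) : ℂ) ^ 2 = 2 := by exact_mod_cast congrArg Complex.ofReal ha
  have hB : ((√3 : ℝ) : ℂ) ^ 2 = 3 := by exact_mod_cast congrArg Complex.ofReal hb
  clear hc hm ha hb
  interval_cases r <;> norm_num [chi2m, sTab] <;>
    generalize ((√2 : ℝ) : ℂ) = a at * <;> generalize ((√3 : ℝ) : ℂ) = b at * <;> grind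

theorem B5 (x : ℝ) : (Polynomial.map (algebraMap ℚ ℝ) (Polynomial.bernoulli 5)).eval x
    = x ^ 5 - 5 / 2 * x ^ 4 + 5 / 3 * x ^ 3 - x / 6 := by
  have h4 : bernoulli 4 = -1 / 30 := by
    rw [bernoulli_eq_bernoulli'_of_ne_one (by norm_num), bernoulli'_four]
  have h3 : bernoulli 3 = 0 := by
    rw [bernoulli_eq_bernoulli'_of_ne_one (by norm_num), bernoulli'_three]
  have h5 : bernoulli 5 = 0 := by
    apply bernoulli_eq_zero_of_odd <;> decide
  simp [Polynomial.bernoulli, Finset.sum_range_succ, bernoulli_zero, bernoulli_one, bernoulli_two,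
    h3, h4, h5, Nat.choose, Polynomial.map_monomial]
  ring

theorem hsin (j : ℕ) (hj : j ≤ 24) : HasSum (fun n : ℕ => 1 / (n : ℝ) ^ 5 * sTab (j * n))
    (-(2 * Real.pi) ^ 5 / 240 * (((j : ℝ) / 24) ^ 5 - 5 / 2 * ((j : ℝ) / 24) ^ 4
      + 5 / 3 * ((j : ℝ) / 24) ^ 3 - ((j : ℝ) / 24) / 6)) := by
  have hj' : (j : ℝ) ≤ 24 := by exact_mod_cast hj
  have h := hasSum_one_div_nat_pow_mul_sin (k := 2) (by norm_num) (x := (j : ℝ) / 24)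
    ⟨by positivity, by linarith⟩
  norm_num only [B5] at h
  convert h using 1
  · funext n
    rw [← sin_tab]
    norm_num
    left; congr 1; ring
  · ring

/-- `L(5,χ_24) = Σ_(n=1)^∞ χ_24(n)/n^5` evaluated in closed form. -/
theorem lseries_chi24_five :
    ∑' n : ℕ, chi2m 12 (n + 1) / ((n : ℂ) + 1) ^ 5 =
      ((Real.pi ^ 5 / 35831808 * ((143460 - 47820 * Real.sqrt 3) * Real.sqrt (2 + Real.sqrt 3) + 342 * Real.sqrt 2 + 68 * Real.sqrt 3 + 3675) : ℝ) : ℂ) := by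
  have ha : √2 ^ 2 = 2 := Real.sq_sqrt (by norm_num)
  have hb : √3 ^ 2 = 3 := Real.sq_sqrt (by norm_num)
  have hab : √(2 + √3) = (√2 * √3 + √2) / 2 := by
    rw [Real.sqrt_eq_iff_mul_self_eq (by positivity) (by positivity)]
    grind
  have H := (((((((hsin 1 (by norm_num)).mul_left (√2 * √3 + √3 + √2 + 2)).add
    ((hsin 3 (by norm_num)).mul_left (1 + √2))).add
    ((hsin 5 (by norm_num)).mul_left (√2 * √3 - √3 - √2 + 2))).add
    ((hsin 7 (by norm_num)).mul_left (√2 * √3 + √3 - √2 - 2))).add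
    ((hsin 9 (by norm_num)).mul_left (√2 - 1))).add
    ((hsin 11 (by norm_num)).mul_left (√2 * √3 - √3 + √2 - 2))).mul_left (1 / 6 : ℝ)
  rw [← hasSum_nat_add_iff' 1] at H
  have H2 := Complex.hasSum_ofReal.mpr H
  rw [← Complex.ofReal_inj.mpr (?_ : _ = _), ← H2.tsum_eq]
  · refine tsum_congr fun n => ?_
    have hc := chi_expand (n + 1)
    push_cast at hc
    rw [hc]
    push_cast
    ring
  · rw [hab]
    simp only [Finset.sum_range_one]
    norm_num
    linear_combination (√2 * Real.pi ^ 5 * (3985 / 5971968)) * hb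
end
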